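/- Let λ be an uncountable cardinal. If there exists a first countable Hausdorff topological space which is (<λ)-CWH but not λ-CWH, then there exists a first countable Hausdorff topological space which is (<λ)-metrizable (hence (<λ)-CWH) but not λ-CWH. -/

import Mathlib

open Cardinal Topology

def SeparatedFamily {X : Type*} [TopologicalSpace X] (Y : Set X) : Prop :=
  ∃ u : Y → Set X, (∀ y, IsOpen (u y)) ∧ (∀ y, (y : X) ∈ u y) ∧
    ∀ y z : Y, y ≠ z → Disjoint (u y) (u z)

def IsCWH (X : Type*) [TopologicalSpace X] : Prop :=
  ∀ Y : Set X, DiscreteTopology Y → SeparatedFamily Y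

/-- A first countable Hausdorff space which is `(<lam)`-CWH but not `lam`-CWH. -/
def Stmt16Hyp (lam : Cardinal) (X : Type) [TopologicalSpace X] : Prop :=
  FirstCountableTopology X ∧ T2Space X ∧
  (∀ Y : Set X, #Y < lam → IsCWH Y) ∧
  ¬∀ Y : Set X, #Y ≤ lam → IsCWH Y

/-- A first countable Hausdorff space which is `(<lam)`-metrizable (hence `(<lam)`-CWH)
but not `lam`-CWH. -/
def Stmt16Concl (lam : Cardinal) (X : Type) [TopologicalSpace X] : Prop :=
  FirstCountableTopology X ∧ T2Space X ∧
  (∀ Y : Set X, #Y < lam → TopologicalSpace.MetrizableSpace Y) ∧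
  (∀ Y : Set X, #Y < lam → IsCWH Y) ∧
  ¬∀ Y : Set X, #Y ≤ lam → IsCWH Y

open Set Filter

theorem IsCWH.of_homeomorph {X Y : Type*} [TopologicalSpace X] [TopologicalSpace Y]
    (e : X ≃ₜ Y) (h : IsCWH X) : IsCWH Y := by
  intro S hS
  have hmaps : MapsTo e (e ⁻¹' S) S := fun _ hx => hx
  have : DiscreteTopology (e ⁻¹' S) :=
    (e.isEmbedding.restrict hmaps).discreteTopology
  obtain ⟨u, hu, hmem, hdisj⟩ := h (e ⁻¹' S) this
  refine ⟨fun y => e.symm ⁻¹' u ⟨e.symm y, by simp⟩, fun y => (hu _).preimage e.symm.continuous,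
    fun y => hmem ⟨e.symm y, by simp⟩, fun y z hyz => ?_⟩
  refine Disjoint.preimage _ (hdisj _ _ fun h => hyz ?_)
  simpa [Subtype.ext_iff] using h

theorem isCWH_of_metrizable (X : Type*) [TopologicalSpace X]
    [TopologicalSpace.MetrizableSpace X] : IsCWH X := by
  let := TopologicalSpace.metrizableSpaceMetric X
  intro Y hY
  have key : ∀ y : Y, ∃ ε > 0, ∀ z : Y, z ≠ y → ε ≤ dist (y : X) z := by
    intro y
    obtain ⟨ε, hε, h⟩ := Metric.isOpen_iff.1 (isOpen_discrete ({y} : Set Y)) y rfl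
    refine ⟨ε, hε, fun z hz => not_lt.1 fun hlt => hz (h ?_)⟩
    rwa [Metric.mem_ball, dist_comm]
  choose ε hε h using key
  refine ⟨fun y => Metric.ball y (ε y / 2), fun y => Metric.isOpen_ball,
    fun y => Metric.mem_ball_self (half_pos (hε y)), fun y z hyz => ?_⟩
  refine Metric.ball_disjoint_ball ?_
  have h₁ := h y z hyz.symm
  have h₂ := h z y hyz
  rw [dist_comm] at h₂
  linarith

/-- The set `D ⊕ I`, topologized so that points of `I` are isolated and a point `d : D` has the
sets `{d} ∪ V k d` as basic neighbourhoods. -/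
def Fan {D I : Type*} (_ : ℕ → D → Set I) := D ⊕ I

namespace Fan

variable {D I : Type*} {V : ℕ → D → Set I}

/-- The non-isolated point of the fan space indexed by `d`. -/
def center (d : D) : Fan V := Sum.inl d

/-- The isolated point of the fan space indexed by `i`. -/
def leaf (i : I) : Fan V := Sum.inr i

theorem center_injective : Function.Injective (center : D → Fan V) := Sum.inl_injective

theorem leaf_injective : Function.Injective (leaf : I → Fan V) := Sum.inr_injective

theorem center_ne_leaf (d : D) (i : I) : (center d : Fan V) ≠ leaf i := Sum.inl_ne_inr

theorem center_or_leaf (x : Fan V) : (∃ d, x = center d) ∨ ∃ i, x = leaf i := by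
  rcases x with d | i
  exacts [.inl ⟨d, rfl⟩, .inr ⟨i, rfl⟩]

instance : TopologicalSpace (Fan V) where
  IsOpen s := ∀ d, center d ∈ s → ∀ᶠ k in atTop, ∀ i ∈ V k d, leaf i ∈ s
  isOpen_univ := by simp
  isOpen_inter s t hs ht d hd := by
    filter_upwards [hs d hd.1, ht d hd.2] with k h₁ h₂ i hi using ⟨h₁ i hi, h₂ i hi⟩
  isOpen_sUnion S hS d := by
    rintro ⟨s, hs, hd⟩
    filter_upwards [hS s hs d hd] with k h i hi using ⟨s, hs, h i hi⟩

theorem isOpen_iff {s : Set (Fan V)} :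
    IsOpen s ↔ ∀ d, center d ∈ s → ∀ᶠ k in atTop, ∀ i ∈ V k d, leaf i ∈ s := Iff.rfl

/-- The basic neighbourhood `{d} ∪ V k d` of `d`. -/
def nbhd (k : ℕ) (d : D) : Set (Fan V) := insert (center d) (leaf '' V k d)

theorem center_mem_nbhd (k : ℕ) (d : D) : (center d : Fan V) ∈ nbhd k d := mem_insert _ _

theorem leaf_mem_nbhd {k : ℕ} {d : D} {i : I} : (leaf i : Fan V) ∈ nbhd k d ↔ i ∈ V k d := by
  simp [nbhd, (center_ne_leaf d i).symm, leaf_injective.eq_iff]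

theorem center_mem_nbhd_iff {k : ℕ} {d e : D} : (center e : Fan V) ∈ nbhd k d ↔ e = d := by
  simp [nbhd, center_injective.eq_iff, (center_ne_leaf _ _).symm]

theorem isOpen_nbhd (hV : Antitone V) (k : ℕ) (d : D) : IsOpen (nbhd k d : Set (Fan V)) := by
  refine isOpen_iff.2 fun e he => ?_
  rw [center_mem_nbhd_iff] at he
  subst he
  filter_upwards [eventually_ge_atTop k] with l hl i hi
  exact leaf_mem_nbhd.2 (hV hl _ hi)

theorem isOpen_leaf (i : I) : IsOpen ({leaf i} : Set (Fan V)) :=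
  isOpen_iff.2 fun d hd => (center_ne_leaf d i hd).elim

theorem nhds_leaf (i : I) : 𝓝 (leaf i : Fan V) = pure (leaf i) :=
  (isOpen_singleton_iff_nhds_eq_pure _).1 (isOpen_leaf i)

theorem hasBasis_nhds_center (hV : Antitone V) (d : D) :
    (𝓝 (center d : Fan V)).HasBasis (fun _ : ℕ => True) fun k => nbhd k d := by
  refine ⟨fun s => ⟨fun hs => ?_, ?_⟩⟩
  · obtain ⟨t, hts, ht, hd⟩ := mem_nhds_iff.1 hs
    obtain ⟨k, hk⟩ := (isOpen_iff.1 ht d hd).exists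
    refine ⟨k, trivial, Subset.trans ?_ hts⟩
    rintro _ (rfl | ⟨i, hi, rfl⟩)
    exacts [hd, hk i hi]
  · rintro ⟨k, -, hk⟩
    exact mem_of_superset ((isOpen_nbhd hV k d).mem_nhds (center_mem_nbhd k d)) hk

theorem firstCountableTopology (hV : Antitone V) : FirstCountableTopology (Fan V) := by
  refine ⟨fun x => ?_⟩
  rcases center_or_leaf x with ⟨d, rfl⟩ | ⟨i, rfl⟩
  · exact (hasBasis_nhds_center hV d).isCountablyGenerated
  · rw [nhds_leaf]
    infer_instance

theorem disjoint_nbhd {k l : ℕ} {d e : D} (hne : d ≠ e) :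
    Disjoint (nbhd k d : Set (Fan V)) (nbhd l e) ↔ Disjoint (V k d) (V l e) := by
  simp only [Set.disjoint_left]
  refine ⟨fun h i hi hi' => h (leaf_mem_nbhd.2 hi) (leaf_mem_nbhd.2 hi'), fun h x hx hx' => ?_⟩
  rcases center_or_leaf x with ⟨c, rfl⟩ | ⟨i, rfl⟩
  · rw [center_mem_nbhd_iff] at hx hx'
    exact hne (hx.symm.trans hx')
  · exact h (leaf_mem_nbhd.1 hx) (leaf_mem_nbhd.1 hx')

theorem t2Space (hV : Antitone V) (hI : ∀ i d, ∃ k, i ∉ V k d)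
    (hD : ∀ d e, d ≠ e → ∃ k l, Disjoint (V k d) (V l e)) : T2Space (Fan V) := by
  have hdi : ∀ d i, ∃ u v : Set (Fan V),
      IsOpen u ∧ IsOpen v ∧ center d ∈ u ∧ leaf i ∈ v ∧ Disjoint u v := by
    intro d i
    obtain ⟨k, hk⟩ := hI i d
    exact ⟨_, _, isOpen_nbhd hV k d, isOpen_leaf i, center_mem_nbhd k d, rfl,
      Set.disjoint_singleton_right.2 fun h => hk (leaf_mem_nbhd.1 h)⟩
  refine ⟨fun x y hxy => ?_⟩
  rcases center_or_leaf x with ⟨d, rfl⟩ | ⟨i, rfl⟩ <;>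
    rcases center_or_leaf y with ⟨e, rfl⟩ | ⟨j, rfl⟩
  · have hne : d ≠ e := fun h => hxy (congrArg _ h)
    obtain ⟨k, l, h⟩ := hD d e hne
    exact ⟨_, _, isOpen_nbhd hV k d, isOpen_nbhd hV l e, center_mem_nbhd k d, center_mem_nbhd l e,
      (disjoint_nbhd hne).2 h⟩
  · exact hdi d j
  · obtain ⟨u, v, hu, hv, h₁, h₂, h⟩ := hdi e i
    exact ⟨v, u, hv, hu, h₂, h₁, h.symm⟩
  · exact ⟨_, _, isOpen_leaf i, isOpen_leaf j, rfl, rfl, Set.disjoint_singleton.2 hxy⟩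

open Classical in
/-- Collapse each neighbourhood `nbhd (max n (f d)) d` with `center d ∈ S` to its center. -/
noncomputable def collapse (S : Set (Fan V)) (f : D → ℕ) (n : ℕ) (x : Fan V) : Fan V :=
  if h : ∃ d, center d ∈ S ∧ x ∈ nbhd (max n (f d)) d then center h.choose else x

variable {S : Set (Fan V)} {f : D → ℕ}

theorem collapse_eq_center (hV : Antitone V)
    (hf : ∀ d e, center d ∈ S → center e ∈ S → d ≠ e → Disjoint (V (f d) d) (V (f e) e))
    {n : ℕ} {d : D} (hd : center d ∈ S) {x : Fan V} (hx : x ∈ nbhd (max n (f d)) d) :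
    collapse S f n x = center d := by
  have h : ∃ d, center d ∈ S ∧ x ∈ nbhd (max n (f d)) d := ⟨d, hd, hx⟩
  rw [collapse, dif_pos h]
  by_contra hne
  have hne' : h.choose ≠ d := fun h' => hne (congrArg _ h')
  refine Set.disjoint_left.1 ((disjoint_nbhd hne').2 ?_) h.choose_spec.2 hx
  exact (hf _ _ h.choose_spec.1 hd hne').mono
    (hV (le_max_right _ _) _) (hV (le_max_right _ _) _)

theorem mem_nbhd_of_collapse_eq_center {n : ℕ} {d : D} {x : Fan V} (hx : x ∈ S)
    (h : collapse S f n x = center d) : x ∈ nbhd (max n (f d)) d := by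
  rw [collapse] at h
  split_ifs at h with h'
  · rw [← center_injective h]
    exact h'.choose_spec.2
  · exact (h' ⟨d, h ▸ hx, h ▸ center_mem_nbhd _ _⟩).elim

theorem eq_of_collapse_eq_leaf {n : ℕ} {i : I} {x : Fan V}
    (h : collapse S f n x = leaf i) : x = leaf i := by
  rw [collapse] at h
  split_ifs at h with h'
  exacts [(center_ne_leaf _ _ h).elim, h]

theorem metrizableSpace_subtype [T2Space (Fan V)] (hV : Antitone V)
    (hI : ∀ i, ∃ k, ∀ d, i ∉ V k d)
    (hf : ∀ d e, center d ∈ S → center e ∈ S → d ≠ e → Disjoint (V (f d) d) (V (f e) e)) :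
    TopologicalSpace.MetrizableSpace S := by
  let : TopologicalSpace (D ⊕ I) := ⊥
  have : DiscreteTopology (D ⊕ I) := ⟨rfl⟩
  let p : S → ℕ → D ⊕ I := fun x n => collapse S f n x
  have hp : Continuous p := by
    refine continuous_pi fun n => continuous_iff_continuousAt.2 fun x => ?_
    refine tendsto_nhds_of_eventually_eq ?_
    obtain ⟨x, hx⟩ := x
    rw [nhds_subtype, eventually_comap]
    rcases center_or_leaf x with ⟨d, rfl⟩ | ⟨i, rfl⟩
    · filter_upwards [(isOpen_nbhd hV (max n (f d)) d).mem_nhds (center_mem_nbhd _ _)]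
      rintro _ hy ⟨y, hyS⟩ rfl
      exact (collapse_eq_center hV hf hx hy).trans
        (collapse_eq_center hV hf hx (center_mem_nbhd _ _)).symm
    · rw [nhds_leaf]
      rintro ⟨y, hyS⟩ (rfl : y = _)
      rfl
  have hopen : ∀ (n : ℕ) (a : D ⊕ I), IsOpen {q : ℕ → D ⊕ I | q n = a} := fun n a =>
    (continuous_apply (A := fun _ : ℕ => D ⊕ I) n).isOpen_preimage {a} (isOpen_discrete _)
  have hind : Topology.IsInducing p := by
    refine Topology.isInducing_iff_nhds.2 fun x => le_antisymm
      (hp.tendsto x).le_comap fun s hs => ?_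
    obtain ⟨x, hx⟩ := x
    rw [nhds_subtype, mem_comap] at hs
    obtain ⟨t, ht, hts⟩ := hs
    rw [mem_comap]
    rcases center_or_leaf x with ⟨d, rfl⟩ | ⟨i, rfl⟩
    · obtain ⟨n, -, hn⟩ := (hasBasis_nhds_center hV d).mem_iff.1 ht
      refine ⟨_, (hopen n (center d : Fan V)).mem_nhds
        (collapse_eq_center hV hf hx (center_mem_nbhd _ _)), fun y hy => hts (hn ?_)⟩
      rcases mem_nbhd_of_collapse_eq_center y.2 hy with h | ⟨j, hj, h⟩
      · exact .inl h
      · exact .inr ⟨j, hV (le_max_left _ _) _ hj, h⟩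
    · obtain ⟨n, hn⟩ := hI i
      refine ⟨_, (hopen n (leaf i : Fan V)).mem_nhds ?_, fun y hy => hts ?_⟩
      · refine dif_neg ?_
        rintro ⟨d, -, hd⟩
        exact hn d (hV (le_max_left _ _) _ (leaf_mem_nbhd.1 hd))
      · rw [mem_preimage, eq_of_collapse_eq_leaf hy]
        exact mem_of_mem_nhds ht
  exact (Topology.IsEmbedding.mk hind hind.injective).metrizableSpace

theorem exists_disjoint_of_isCWH (hV : Antitone V) (h : IsCWH (Fan V)) :
    ∃ f : D → ℕ, ∀ d e, d ≠ e → Disjoint (V (f d) d) (V (f e) e) := by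
  have hdisc : DiscreteTopology (range (center : D → Fan V)) := by
    refine discreteTopology_iff_forall_isOpen.2 fun s => ?_
    refine ⟨⋃ d ∈ {d | (⟨center d, d, rfl⟩ : range (center : D → Fan V)) ∈ s}, nbhd 0 d,
      isOpen_biUnion fun d _ => isOpen_nbhd hV 0 d, ?_⟩
    ext ⟨_, d, rfl⟩
    simp [center_mem_nbhd_iff]
  obtain ⟨u, hu, hmem, hdisj⟩ := h _ hdisc
  have key : ∀ d, ∃ k, nbhd k d ⊆ u ⟨center d, d, rfl⟩ := fun d => by
    obtain ⟨k, -, hk⟩ := (hasBasis_nhds_center hV d).mem_iff.1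
      ((hu _).mem_nhds (hmem ⟨center d, d, rfl⟩))
    exact ⟨k, hk⟩
  choose f hf using key
  refine ⟨f, fun d e hde => (disjoint_nbhd hde).1 ((hdisj _ _ fun h => hde ?_).mono (hf d) (hf e))⟩
  exact center_injective (congrArg Subtype.val h)

end Fan

/-- If `R d n e m` records whether the `n`-th neighbourhood of `d` meets the `m`-th neighbourhood of
`e`, then `incidence R k d` is the set of meeting pairs involving a neighbourhood of `d` of index
at least `k`. -/
def incidence {D : Type*} (R : D → ℕ → D → ℕ → Prop) (k : ℕ) (d : D) :
    Set {p : (D × ℕ) × (D × ℕ) // p.1.1 ≠ p.2.1 ∧ R p.1.1 p.1.2 p.2.1 p.2.2} :=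
  {p | p.1.1.1 = d ∧ k ≤ p.1.1.2 ∨ p.1.2.1 = d ∧ k ≤ p.1.2.2}

theorem antitone_incidence {D : Type*} (R : D → ℕ → D → ℕ → Prop) : Antitone (incidence R) := by
  rintro k l hkl d p (⟨h, h'⟩ | ⟨h, h'⟩)
  exacts [.inl ⟨h, hkl.trans h'⟩, .inr ⟨h, hkl.trans h'⟩]

theorem disjoint_incidence_iff {D : Type*} {R : D → ℕ → D → ℕ → Prop}
    (hsymm : ∀ d n e m, R d n e m → R e m d n)
    (hanti : ∀ d n e m k l, k ≤ n → l ≤ m → R d n e m → R d k e l)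
    {d e : D} (hne : d ≠ e) (k l : ℕ) :
    Disjoint (incidence R k d) (incidence R l e) ↔ ¬ R d k e l := by
  rw [Set.disjoint_left]
  refine ⟨fun h hR => ?_, ?_⟩
  · exact h (a := ⟨((d, k), (e, l)), hne, hR⟩) (.inl ⟨rfl, le_rfl⟩) (.inr ⟨rfl, le_rfl⟩)
  · rintro h ⟨⟨⟨a, n⟩, ⟨b, m⟩⟩, hab, hR⟩ (⟨h₁, h₂⟩ | ⟨h₁, h₂⟩) (⟨h₃, h₄⟩ | ⟨h₃, h₄⟩) <;>
      dsimp only at h₁ h₂ h₃ h₄ hab hR <;> subst h₁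
    · exact hne h₃
    · subst h₃
      exact h (hanti _ _ _ _ _ _ h₂ h₄ hR)
    · subst h₃
      exact h (hanti _ _ _ _ _ _ h₂ h₄ (hsymm _ _ _ _ hR))
    · exact hne h₃

theorem stmt16Concl_fan_incidence {lam : Cardinal} (hlam : ℵ₀ ≤ lam) {D : Type} (hD : #D ≤ lam)
    {R : D → ℕ → D → ℕ → Prop} (hsymm : ∀ d n e m, R d n e m → R e m d n)
    (hanti : ∀ d n e m k l, k ≤ n → l ≤ m → R d n e m → R d k e l)
    (hsep : ∀ d e, d ≠ e → ∃ k l, ¬ R d k e l)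
    (hsmall : ∀ E : Set D, #E < lam →
      ∃ f : D → ℕ, ∀ d ∈ E, ∀ e ∈ E, d ≠ e → ¬ R d (f d) e (f e))
    (hbig : ¬ ∃ f : D → ℕ, ∀ d e, d ≠ e → ¬ R d (f d) e (f e)) :
    Stmt16Concl lam (Fan (incidence R)) := by
  have hV := antitone_incidence R
  have hI : ∀ i, ∃ k, ∀ d, i ∉ incidence R k d := by
    rintro ⟨⟨⟨a, n⟩, ⟨b, m⟩⟩, hab, hR⟩
    refine ⟨max n m + 1, ?_⟩
    rintro d (⟨-, h⟩ | ⟨-, h⟩) <;> dsimp only at h <;> omega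
  have : T2Space (Fan (incidence R)) := Fan.t2Space hV
    (fun i d => (hI i).imp fun k hk => hk d) fun d e hne => by
      simpa only [disjoint_incidence_iff hsymm hanti hne] using hsep d e hne
  have hmet : ∀ S : Set (Fan (incidence R)), #S < lam → TopologicalSpace.MetrizableSpace S := by
    intro S hS
    obtain ⟨f, hf⟩ := hsmall (Fan.center ⁻¹' S)
      ((mk_preimage_of_injective _ _ Fan.center_injective).trans_lt hS)
    exact Fan.metrizableSpace_subtype hV hI fun d e hd he hne =>
      (disjoint_incidence_iff hsymm hanti hne _ _).2 (hf d hd e he hne)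
  refine ⟨Fan.firstCountableTopology hV, this, hmet, fun S hS => ?_, fun h => hbig ?_⟩
  · have := hmet S hS
    exact isCWH_of_metrizable S
  · have hcard : #(univ : Set (Fan (incidence R))) ≤ lam := by
      have hDN : #(D × ℕ) ≤ lam := by
        rw [mk_prod, lift_id, lift_id, mk_nat]
        exact mul_le_of_le hlam hD hlam
      rw [mk_univ]
      change #(D ⊕ _) ≤ lam
      rw [mk_sum, lift_id, lift_id]
      refine add_le_of_le hlam hD ((mk_subtype_le _).trans ?_)
      rw [← mul_def]
      exact mul_le_of_le hlam hDN hDN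
    obtain ⟨f, hf⟩ := Fan.exists_disjoint_of_isCWH hV
      ((h univ hcard).of_homeomorph (Homeomorph.Set.univ _))
    exact ⟨f, fun d e hne => (disjoint_incidence_iff hsymm hanti hne _ _).1 (hf d e hne)⟩

/-- In a space all of whose subspaces of cardinality `< lam` are CWH, a discrete set of cardinality
`< lam` can be separated by basic neighbourhoods. -/
theorem exists_disjoint_basic_of_small {lam : Cardinal} (hlam : ℵ₀ < lam) {Z : Type}
    [TopologicalSpace Z] (hcwh : ∀ W : Set Z, #W < lam → IsCWH W)
    {U : Z → ℕ → Set Z} (hU : ∀ z, (𝓝 z).HasAntitoneBasis (U z))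
    {E : Set Z} (hE : DiscreteTopology E) (hcard : #E < lam) :
    ∃ f : Z → ℕ, ∀ d ∈ E, ∀ e ∈ E, d ≠ e → Disjoint (U d (f d)) (U e (f e)) := by
  classical
  let w : (E × ℕ) × (E × ℕ) → Z := fun p =>
    if h : (U p.1.1 p.1.2 ∩ U p.2.1 p.2.2).Nonempty then h.some else p.1.1
  let W : Set Z := E ∪ range w
  have hEN : #(E × ℕ) < lam := by
    rw [mk_prod, lift_id, lift_id, mk_nat]
    exact mul_lt_of_lt hlam.le hcard hlam
  have hW : #W < lam := by
    refine (mk_union_le _ _).trans_lt (add_lt_of_lt hlam.le hcard (mk_range_le.trans_lt ?_))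
    rw [← mul_def]
    exact mul_lt_of_lt hlam.le hEN hEN
  have hmaps : MapsTo (Subtype.val : W → Z) (Subtype.val ⁻¹' E) E := fun _ hx => hx
  have hdisc : DiscreteTopology (Subtype.val ⁻¹' E : Set W) :=
    (Topology.IsEmbedding.subtypeVal.restrict hmaps).discreteTopology
  obtain ⟨u, hu, hmem, hdisj⟩ := hcwh W hW _ hdisc
  have key : ∀ d : Z, ∃ n, ∀ hd : d ∈ E, ∀ x (hx : x ∈ W), x ∈ U d n →
      (⟨x, hx⟩ : W) ∈ u ⟨⟨d, .inl hd⟩, hd⟩ := by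
    intro d
    by_cases hd : d ∈ E
    · have := (hu ⟨⟨d, .inl hd⟩, hd⟩).mem_nhds (hmem _)
      rw [nhds_subtype, ((hU d).1.comap _).mem_iff] at this
      obtain ⟨n, -, hn⟩ := this
      exact ⟨n, fun _ x hx hxU => hn hxU⟩
    · exact ⟨0, fun h => (hd h).elim⟩
  choose f hf using key
  refine ⟨f, fun d hd e he hne => ?_⟩
  rw [Set.disjoint_iff_inter_eq_empty, ← Set.not_nonempty_iff_eq_empty]
  intro h
  have hw : w ((⟨d, hd⟩, f d), (⟨e, he⟩, f e)) = h.some := dif_pos h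
  have hWmem : h.some ∈ W := .inr ⟨_, hw⟩
  refine Set.disjoint_left.1 (hdisj _ _ fun h' => hne ?_)
    (hf d hd _ hWmem h.some_mem.1) (hf e he _ hWmem h.some_mem.2)
  exact congrArg (fun x => (x.1 : Z)) h'

theorem stmt16 (lam : Cardinal) (hlam : ℵ₀ < lam)
    (h : ∃ (X : Type) (t : TopologicalSpace X), @Stmt16Hyp lam X t) :
    ∃ (X : Type) (t : TopologicalSpace X), @Stmt16Concl lam X t := by
  obtain ⟨X, t, hfc, ht2, hsmall, hbig⟩ := h
  simp only [not_forall] at hbig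
  obtain ⟨Y, hYcard, hY⟩ := hbig
  have hcwh : ∀ W : Set Y, #W < lam → IsCWH W := fun W hW =>
    (hsmall (Subtype.val '' W) (mk_image_le.trans_lt hW)).of_homeomorph
      (Topology.IsEmbedding.subtypeVal.homeomorphImage W).symm
  simp only [IsCWH, not_forall] at hY
  obtain ⟨D, hdisc, hD⟩ := hY
  choose U hU using fun z : Y => (𝓝 z).exists_antitone_basis
  refine ⟨_, _, stmt16Concl_fan_incidence hlam.le (D := D) ((mk_set_le D).trans hYcard)
    (R := fun d n e m => ¬ Disjoint (U d n) (U e m))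
    (fun d n e m h h' => h h'.symm)
    (fun d n e m k l hk hl h h' => h (h'.mono ((hU _).2 hk) ((hU _).2 hl)))
    (fun d e hne => ?_) (fun E hE => ?_) ?_⟩
  · obtain ⟨k, -, l, -, h⟩ := ((hU d).1.disjoint_iff (hU e).1).1
      (disjoint_nhds_nhds.2 fun h => hne (Subtype.ext h))
    exact ⟨k, l, not_not.2 h⟩
  · obtain ⟨f, hf⟩ := exists_disjoint_basic_of_small hlam hcwh hU (E := Subtype.val '' E)
      (DiscreteTopology.of_subset hdisc (Subtype.coe_image_subset _ _)) (mk_image_le.trans_lt hE)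
    exact ⟨fun d => f d, fun d hd e he hne => not_not.2
      (hf d ⟨d, hd, rfl⟩ e ⟨e, he, rfl⟩ fun h => hne (Subtype.ext h))⟩
  · rintro ⟨f, hf⟩
    refine hD ⟨fun d => interior (U d (f d)), fun d => isOpen_interior,
      fun d => mem_interior_iff_mem_nhds.2 ((hU d).1.mem_of_mem trivial), fun d e hne => ?_⟩
    exact (not_not.1 (hf d e hne)).mono interior_subset interior_subset
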